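/- (Deterministic SHB identity.) Let (x^t), (g^t), (d^t) be sequences of vectors in a finite-dimensional real inner product space satisfying x^{t+1} = x^t − α d^t for all t ≥ 0 and d^t = (1−β) g^t + β d^{t−1} for all t ≥ 1, where α is a nonzero real number and β ∈ [0,1). Then for every k ≥ 1: ⟨x^k, g^k⟩ − (α/2)·((1+β)/(1−β))·‖d^k‖² = (1/(2α(1−β)))·[ (β‖x^k‖² − ‖x^{k+1}‖² − α²β‖d^k‖²) − (β‖x^{k−1}‖² − ‖x^k‖² − α²β‖d^{k−1}‖²) ]. -/

import Mathlib

open scoped RealInnerProductSpace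

/-- Deterministic SHB identity: for the heavy-ball recursion
`x^{t+1} = x^t - α d^t`, `d^t = (1-β) g^t + β d^{t-1}`, with `α ≠ 0` and `β ∈ [0,1)`,
Yaida's statistic equals a difference of consecutive values of the test function
`β‖x‖² - ‖x⁺‖² - α²β‖d‖²`. -/
theorem stmt5
    {E : Type*} [NormedAddCommGroup E] [InnerProductSpace ℝ E] [FiniteDimensional ℝ E]
    {x g d : ℕ → E} {α β : ℝ} (hα : α ≠ 0) (hβ0 : 0 ≤ β) (hβ1 : β < 1)
    (hupd : ∀ t, x (t + 1) = x t - α • d t)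
    (hdir : ∀ t, d (t + 1) = (1 - β) • g (t + 1) + β • d t) :
    ∀ k, 1 ≤ k →
      ⟪x k, g k⟫ - α / 2 * ((1 + β) / (1 - β)) * ‖d k‖ ^ 2 =
        1 / (2 * α * (1 - β)) *
          ((β * ‖x k‖ ^ 2 - ‖x (k + 1)‖ ^ 2 - α ^ 2 * β * ‖d k‖ ^ 2) -
            (β * ‖x (k - 1)‖ ^ 2 - ‖x k‖ ^ 2 - α ^ 2 * β * ‖d (k - 1)‖ ^ 2)) := by
  intro k hk
  obtain ⟨n, rfl⟩ : ∃ n, k = n + 1 := ⟨k - 1, by omega⟩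
  have hb : (1 - β) ≠ 0 := by linarith
  rw [Nat.add_sub_cancel]
  have h1 : ‖x (n + 1 + 1)‖ ^ 2 = ‖x (n + 1)‖ ^ 2 - 2 * (α * ⟪x (n + 1), d (n + 1)⟫)
      + α ^ 2 * ‖d (n + 1)‖ ^ 2 := by
    rw [hupd (n + 1), norm_sub_sq_real, inner_smul_right, norm_smul, mul_pow,
      Real.norm_eq_abs, sq_abs]
  have h2 : ‖x n‖ ^ 2 = ‖x (n + 1)‖ ^ 2 + 2 * (α * ⟪x (n + 1), d n⟫)
      + α ^ 2 * ‖d n‖ ^ 2 := by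
    have h : x n = x (n + 1) + α • d n := by rw [hupd n]; abel
    rw [h, norm_add_sq_real, inner_smul_right, norm_smul, mul_pow,
      Real.norm_eq_abs, sq_abs]
  have h3 : ⟪x (n + 1), d (n + 1)⟫ = (1 - β) * ⟪x (n + 1), g (n + 1)⟫
      + β * ⟪x (n + 1), d n⟫ := by
    rw [hdir n, inner_add_right, inner_smul_right, inner_smul_right]
  rw [h1, h2, h3]
  field_simp
  ring
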